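/- For all D₁, D₂ ∈ 𝔞_g(1), the commutator [D₁,D₂] lies in 𝔞_g(2) and satisfies C₁₃(([D₁,D₂])*) = 0 in H^{⊗2}. -/

import Mathlib

/- Coordinate model of the symplectic vector space `H = ℚ^{2g}` and its tensor powers.
`I g` indexes the symplectic basis `x_1, …, x_g, y_1, …, y_g`;
`T g m` is the coordinate model of `H^{⊗ m}` (coordinates w.r.t. the basis tensors). -/

abbrev I (g : ℕ) := Fin g ⊕ Fin g
abbrev H (g : ℕ) := I g → ℚ
abbrev T (g m : ℕ) := (Fin m → I g) → ℚ

/-- the basis vector `x_i` -/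
def xB (g : ℕ) (i : Fin g) : H g := Pi.single (Sum.inl i) 1
/-- the basis vector `y_i` -/
def yB (g : ℕ) (i : Fin g) : H g := Pi.single (Sum.inr i) 1

/-- the symplectic intersection pairing `u · v` -/
def pairH (g : ℕ) (u v : H g) : ℚ :=
  ∑ i : Fin g, (u (Sum.inl i) * v (Sum.inr i) - u (Sum.inr i) * v (Sum.inl i))

/-- `D(ω₀) = (D ⊗ id + id ⊗ D)(ω₀)` for `ω₀ = Σᵢ (xᵢ ⊗ yᵢ - yᵢ ⊗ xᵢ)`. -/
def Dom (g k : ℕ) (D : H g →ₗ[ℚ] T g (k+1)) : T g (k+2) := fun φ =>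
  ∑ i : Fin g,
    (D (xB g i) (fun p => φ p.castSucc) * yB g i (φ (Fin.last (k+1)))
      + xB g i (φ 0) * D (yB g i) (fun p => φ p.succ)
      - D (yB g i) (fun p => φ p.castSucc) * xB g i (φ (Fin.last (k+1)))
      - yB g i (φ 0) * D (xB g i) (fun p => φ p.succ))

/-- `D* = Σᵢ (xᵢ ⊗ D(yᵢ) - yᵢ ⊗ D(xᵢ))`. -/
def dstar (g k : ℕ) (D : H g →ₗ[ℚ] T g (k+1)) : T g (k+2) := fun φ =>
  ∑ i : Fin g,
    (xB g i (φ 0) * D (yB g i) (fun p => φ p.succ)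
      - yB g i (φ 0) * D (xB g i) (fun p => φ p.succ))

/-- the cyclic permutation `σ_m : u₁ ⊗ ⋯ ⊗ u_m ↦ u₂ ⊗ ⋯ ⊗ u_m ⊗ u₁`. -/
def cyc (g m : ℕ) (t : T g m) : T g m := fun φ => t (φ ∘ (finRotate m).symm)

/-- The unique extension of `D : H → H^{⊗(k+1)}` to a derivation of the tensor algebra,
restricted to a map `H^{⊗m} → H^{⊗(m+k)}` (in coordinates): on decomposables it is
`u₁⊗⋯⊗u_m ↦ Σ_p u₁⊗⋯⊗D(u_p)⊗⋯⊗u_m`. -/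
def ext (g k m : ℕ) (D : H g →ₗ[ℚ] T g (k+1)) : T g m →ₗ[ℚ] T g (m+k) where
  toFun t := fun ψ =>
    ∑ p : Fin m, ∑ c : I g,
      D (Pi.single c 1) (fun r : Fin (k+1) => ψ ⟨p.1 + r.1, by have := p.2; have := r.2; omega⟩)
        * t (fun q : Fin m =>
            if q.1 < p.1 then ψ ⟨q.1, by have := q.2; omega⟩
            else if q = p then c
            else ψ ⟨q.1 + k, by have := q.2; omega⟩)
  map_add' t t' := by
    funext ψ
    simp only [Pi.add_apply]
    rw [← Finset.sum_add_distrib]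
    refine Finset.sum_congr rfl fun p _ => ?_
    rw [← Finset.sum_add_distrib]
    refine Finset.sum_congr rfl fun c _ => ?_
    ring
  map_smul' a t := by
    funext ψ
    simp only [Pi.smul_apply, smul_eq_mul, RingHom.id_apply]
    rw [Finset.mul_sum]
    refine Finset.sum_congr rfl fun p _ => ?_
    rw [Finset.mul_sum]
    refine Finset.sum_congr rfl fun c _ => ?_
    ring

/-- The bracket `[D₁, D₂]` of two degree one elements, i.e. the restriction to `H` of
`D̃₁ ∘ D̃₂ - D̃₂ ∘ D̃₁`. -/
def brkt11 (g : ℕ) (D₁ D₂ : H g →ₗ[ℚ] T g 2) : H g →ₗ[ℚ] T g 3 :=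
  (ext g 1 2 D₁) ∘ₗ D₂ - (ext g 1 2 D₂) ∘ₗ D₁

/-- the contraction `C₁₃ : H^{⊗4} → H^{⊗2}`, `u₁⊗u₂⊗u₃⊗u₄ ↦ (u₁·u₃) u₂⊗u₄`. -/
def C13 (g : ℕ) (t : T g 4) : T g 2 := fun φ =>
  ∑ a : I g, ∑ b : I g,
    pairH g (Pi.single a 1) (Pi.single b 1) * t ![a, φ 0, b, φ 1]

/-- The sign of a basis vector: `1` on the `x_i` and `-1` on the `y_i`. -/
def basisSign (g : ℕ) (a : I g) : ℚ := Sum.elim (fun _ => 1) (fun _ => -1) a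

theorem basisSign_swap (g : ℕ) (a : I g) : basisSign g a.swap = -basisSign g a := by
  cases a <;> simp [basisSign]

theorem basisSign_mul_self (g : ℕ) (a : I g) : basisSign g a * basisSign g a = 1 := by
  cases a <;> simp [basisSign]

theorem sum_swap (g : ℕ) (f : I g → ℚ) : ∑ a : I g, f a.swap = ∑ a, f a :=
  Equiv.sum_comp (Equiv.sumComm (Fin g) (Fin g)) f

/-- The coordinates of `D*`, with the first index separated from the others. -/
def starCoord (g k : ℕ) (D : H g →ₗ[ℚ] T g (k+1)) (a : I g) : T g (k+1) := fun v =>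
  basisSign g a * D (Pi.single a.swap 1) v

theorem apply_single_eq_starCoord (g k : ℕ) (D : H g →ₗ[ℚ] T g (k+1)) (a : I g)
    (v : Fin (k+1) → I g) :
    D (Pi.single a 1) v = -basisSign g a * starCoord g k D a.swap v := by
  rw [starCoord, basisSign_swap, Sum.swap_swap, ← mul_assoc, neg_mul_neg, basisSign_mul_self,
    one_mul]

theorem dstar_apply (g k : ℕ) (D : H g →ₗ[ℚ] T g (k+1)) (φ : Fin (k+2) → I g) :
    dstar g k D φ = starCoord g k D (φ 0) (fun p => φ p.succ) := by
  simp only [dstar, starCoord, xB, yB]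
  rcases φ 0 with i | i <;> simp [Pi.single_apply, basisSign]

theorem Dom_apply (g k : ℕ) (D : H g →ₗ[ℚ] T g (k+1)) (φ : Fin (k+2) → I g) :
    Dom g k D φ = starCoord g k D (φ 0) (fun p => φ p.succ)
      - starCoord g k D (φ (Fin.last (k+1))) (fun p => φ p.castSucc) := by
  rw [← dstar_apply]
  have h : starCoord g k D (φ (Fin.last (k+1))) (fun p => φ p.castSucc)
      = ∑ i : Fin g,
        (xB g i (φ (Fin.last (k+1))) * D (yB g i) (fun p => φ p.castSucc)
          - yB g i (φ (Fin.last (k+1))) * D (xB g i) (fun p => φ p.castSucc)) := by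
    simp only [starCoord, xB, yB]
    rcases φ (Fin.last (k+1)) with i | i <;> simp [Pi.single_apply, basisSign]
  rw [h, Dom, dstar, ← Finset.sum_sub_distrib]
  exact Finset.sum_congr rfl fun i _ => by ring

theorem starCoord_rotate (g : ℕ) (D : H g →ₗ[ℚ] T g 2) (h : Dom g 1 D = 0) (a b c : I g) :
    starCoord g 1 D a ![b, c] = starCoord g 1 D c ![a, b] := by
  have h' := congrFun h ![a, b, c]
  have e₁ : (fun p : Fin 2 => ![a, b, c] p.succ) = ![b, c] := by
    funext p; fin_cases p <;> rfl
  have e₂ : (fun p : Fin 2 => ![a, b, c] p.castSucc) = ![a, b] := by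
    funext p; fin_cases p <;> rfl
  rw [Dom_apply, Pi.zero_apply, sub_eq_zero, e₁, e₂] at h'
  exact h'

theorem ext_one_two_apply (g : ℕ) (D : H g →ₗ[ℚ] T g 2) (t : T g 2) (b c d : I g) :
    ext g 1 2 D t ![b, c, d]
      = ∑ e, (D (Pi.single e 1) ![b, c] * t ![e, d] + D (Pi.single e 1) ![c, d] * t ![b, e]) := by
  simp only [ext, LinearMap.coe_mk, AddHom.coe_mk, Fin.sum_univ_two]
  rw [← Finset.sum_add_distrib]
  refine Finset.sum_congr rfl fun e _ => ?_
  congr 2 <;> refine congrArg _ (funext fun p => ?_) <;> fin_cases p <;> rfl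

/-- The contraction of `D₂* ⊗ D₁*` in the last slot of `D₂*` and the first slot of `D₁*`. -/
def joinStar (g : ℕ) (D₁ D₂ : H g →ₗ[ℚ] T g 2) (a b c d : I g) : ℚ :=
  ∑ e, basisSign g e * starCoord g 1 D₂ a ![b, e] * starCoord g 1 D₁ e.swap ![c, d]

theorem joinStar_comm (g : ℕ) (D₁ D₂ : H g →ₗ[ℚ] T g 2)
    (h₁ : Dom g 1 D₁ = 0) (h₂ : Dom g 1 D₂ = 0) (a b c d : I g) :
    joinStar g D₂ D₁ a b c d = -joinStar g D₁ D₂ c d a b := by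
  rw [joinStar, joinStar, ← sum_swap, ← Finset.sum_neg_distrib]
  refine Finset.sum_congr rfl fun e _ => ?_
  rw [basisSign_swap, Sum.swap_swap, starCoord_rotate g D₁ h₁ a, starCoord_rotate g D₂ h₂ c]
  ring

theorem starCoord_brkt11 (g : ℕ) (D₁ D₂ : H g →ₗ[ℚ] T g 2)
    (h₁ : Dom g 1 D₁ = 0) (h₂ : Dom g 1 D₂ = 0) (a b c d : I g) :
    starCoord g 2 (brkt11 g D₁ D₂) a ![b, c, d]
      = -(joinStar g D₁ D₂ d a b c + joinStar g D₁ D₂ a b c d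
        + joinStar g D₁ D₂ b c d a + joinStar g D₁ D₂ c d a b) := by
  have key (D D' : H g →ₗ[ℚ] T g 2) (h' : Dom g 1 D' = 0) :
      basisSign g a * ext g 1 2 D (D' (Pi.single a.swap 1)) ![b, c, d]
        = -(joinStar g D D' d a b c + joinStar g D D' a b c d) := by
    rw [ext_one_two_apply, joinStar, joinStar, ← Finset.sum_add_distrib, Finset.mul_sum,
      ← Finset.sum_neg_distrib]
    refine Finset.sum_congr rfl fun e _ => ?_
    rw [← starCoord_rotate g D' h' a e d, apply_single_eq_starCoord g 1 D e,
      apply_single_eq_starCoord g 1 D e]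
    simp only [starCoord]
    ring
  have e₁ := key D₁ D₂ h₂
  have e₂ := key D₂ D₁ h₁
  rw [joinStar_comm g D₁ D₂ h₁ h₂, joinStar_comm g D₁ D₂ h₁ h₂] at e₂
  simp only [starCoord, brkt11, LinearMap.sub_apply, LinearMap.comp_apply, Pi.sub_apply, mul_sub]
  linarith

theorem pairH_single (g : ℕ) (a b : I g) :
    pairH g (Pi.single a 1) (Pi.single b 1) = if b = a.swap then basisSign g a else 0 := by
  rcases a with i | i <;> rcases b with j | j <;>
    simp [pairH, basisSign, Pi.single_apply, eq_comm]
  split_ifs <;> simp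

theorem C13_apply (g : ℕ) (t : T g 4) (φ : Fin 2 → I g) :
    C13 g t φ = ∑ a, basisSign g a * t ![a, φ 0, a.swap, φ 1] := by
  simp [C13, pairH_single]

theorem sum_joinStar_swap (g : ℕ) (D₁ D₂ : H g →ₗ[ℚ] T g 2)
    (h₁ : Dom g 1 D₁ = 0) (h₂ : Dom g 1 D₂ = 0) (b d : I g) :
    ∑ a, basisSign g a * joinStar g D₁ D₂ a.swap d a b
      = -∑ a, basisSign g a * joinStar g D₁ D₂ d a b a.swap := by
  simp only [joinStar, Finset.mul_sum]
  rw [Finset.sum_comm, ← Finset.sum_neg_distrib]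
  refine Finset.sum_congr rfl fun e _ => ?_
  rw [← sum_swap, ← Finset.sum_neg_distrib]
  refine Finset.sum_congr rfl fun a _ => ?_
  rw [basisSign_swap, Sum.swap_swap, ← starCoord_rotate g D₂ h₂ d e a,
    starCoord_rotate g D₁ h₁ e.swap, starCoord_rotate g D₁ h₁ b]
  ring

/-- for `D₁, D₂ ∈ 𝔞_g(1)`, the commutator `[D₁,D₂]` lies in `𝔞_g(2)` and
satisfies `C₁₃(([D₁,D₂])*) = 0`. -/
theorem stmt7 (g : ℕ) (hg : 1 ≤ g) (D₁ D₂ : H g →ₗ[ℚ] T g 2)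
    (h₁ : Dom g 1 D₁ = 0) (h₂ : Dom g 1 D₂ = 0) :
    Dom g 2 (brkt11 g D₁ D₂) = 0 ∧ C13 g (dstar g 2 (brkt11 g D₁ D₂)) = 0 := by
  constructor
  · funext φ
    have e₁ : (fun p : Fin 3 => φ p.succ) = ![φ 1, φ 2, φ 3] := by
      funext p; fin_cases p <;> rfl
    have e₂ : (fun p : Fin 3 => φ p.castSucc) = ![φ 0, φ 1, φ 2] := by
      funext p; fin_cases p <;> rfl
    have e₃ : φ (Fin.last 3) = φ 3 := rfl
    rw [Dom_apply, e₁, e₂, e₃, starCoord_brkt11 g D₁ D₂ h₁ h₂, starCoord_brkt11 g D₁ D₂ h₁ h₂,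
      Pi.zero_apply]
    ring
  · funext φ
    have e (a : I g) : dstar g 2 (brkt11 g D₁ D₂) ![a, φ 0, a.swap, φ 1]
        = starCoord g 2 (brkt11 g D₁ D₂) a ![φ 0, a.swap, φ 1] := by
      rw [dstar_apply]
      rfl
    have s₁ := sum_joinStar_swap g D₁ D₂ h₁ h₂ (φ 0) (φ 1)
    have s₂ := sum_joinStar_swap g D₁ D₂ h₁ h₂ (φ 1) (φ 0)
    rw [← sum_swap, ← sum_swap g fun a => _ * joinStar g D₁ D₂ (φ 0) a _ _] at s₂
    simp only [Sum.swap_swap, basisSign_swap, neg_mul, Finset.sum_neg_distrib] at s₂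
    simp only [C13_apply, e, starCoord_brkt11 g D₁ D₂ h₁ h₂, mul_neg, mul_add,
      Finset.sum_neg_distrib, Finset.sum_add_distrib, Pi.zero_apply]
    linarith
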